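/- Let θ_k be uniformly distributed over plane trees with k edges and C_k its contour function. For every integer p ≥ 1, there exists a constant K_p such that for all k ≥ 1 and all i ∈ {0, 1, ..., 2k}, E[C_k(i)^{2p}] ≤ K_p · i^p. -/

import Mathlib

/-- Plane trees: a tree is a root together with an ordered (finite) list of subtrees. -/
inductive PTree where
  | node : List PTree → PTree

mutual
  /-- Number of edges of a plane tree. -/
  def PTree.numEdges : PTree → ℕ
    | .node ts => PTree.numEdgesList ts
  def PTree.numEdgesList : List PTree → ℕ
    | [] => 0
    | t :: ts => PTree.numEdges t + 1 + PTree.numEdgesList ts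
end

mutual
  /-- The contour function of a plane tree evaluated at integer times `0, ..., 2k`. -/
  def PTree.contour : PTree → List ℕ
    | .node ts => 0 :: PTree.contourList ts
  def PTree.contourList : List PTree → List ℕ
    | [] => []
    | t :: ts => (PTree.contour t).map (· + 1) ++ [0] ++ PTree.contourList ts
end

/-- Contour of a stack of forests. -/
def stackContour : List (List PTree) → List ℕ
  | [] => []
  | F :: r => (r.length :: (PTree.contourList F).map (· + r.length)) ++ stackContour r

/-- Total number of edges of a stack of forests. -/
def stackEdges : List (List PTree) → ℕ
  | [] => 0
  | F :: r => PTree.numEdgesList F + stackEdges r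

/-- Undo an upward step. -/
def stackUp : List (List PTree) → List (List PTree)
  | a :: b :: r => (PTree.node a :: b) :: r
  | s => s

open Classical in
/-- All stacks of length `L` with `m` remaining contour steps. -/
noncomputable def stkSet : ℕ → ℕ → Finset (List (List PTree))
  | 0, 1 => {[[]]}
  | 0, _ => ∅
  | _ + 1, 0 => ∅
  | m + 1, L + 1 => (stkSet m (L + 2)).image stackUp ∪ (stkSet m L).image (fun s => [] :: s)

theorem mem_stacks (m L : ℕ) (s : List (List PTree)) :
    s ∈ stkSet m L ↔ s.length = L ∧ 1 ≤ L ∧ 2 * stackEdges s + L = m + 1 := by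
  induction m generalizing L s with
  | zero =>
    match L with
    | 0 => simp [stkSet]
    | 1 =>
      simp only [stkSet, Finset.mem_singleton]
      constructor
      · rintro rfl; simp [stackEdges, PTree.numEdgesList]
      · rintro ⟨h1, -, h2⟩
        match s, h1 with
        | [[]], _ => rfl
        | [t :: ts], _ => simp [stackEdges, PTree.numEdgesList] at h2
    | L + 2 =>
      simp only [stkSet, Finset.notMem_empty, false_iff]
      omega
  | succ m ih =>
    match L with
    | 0 => simp [stkSet]
    | L + 1 =>
      simp only [stkSet, Finset.mem_union, Finset.mem_image, ih]
      constructor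
      · rintro (⟨a, ⟨h1, h2, h3⟩, rfl⟩ | ⟨a, ⟨h1, h2, h3⟩, rfl⟩)
        · match a, h1 with
          | a :: b :: r, h1 =>
            simp only [stackUp, stackEdges, PTree.numEdgesList, PTree.numEdges,
              List.length_cons] at *
            omega
        · simp only [stackEdges, PTree.numEdgesList, List.length_cons] at *
          omega
      · rintro ⟨h1, h2, h3⟩
        match s, h1 with
        | [] :: r, h1 =>
          right
          refine ⟨r, ?_, rfl⟩
          have hr : r = [] → stackEdges r = 0 := by rintro rfl; rfl
          rw [← List.length_eq_zero_iff] at hr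
          simp only [stackEdges, PTree.numEdgesList, List.length_cons] at *
          omega
        | (PTree.node a :: b) :: r, h1 =>
          left
          refine ⟨a :: b :: r, ?_, rfl⟩
          simp only [stackEdges, PTree.numEdgesList, PTree.numEdges, List.length_cons] at *
          omega

theorem stackContour_up (a b : List PTree) (r : List (List PTree)) :
    stackContour (stackUp (a :: b :: r)) = r.length :: stackContour (a :: b :: r) := by
  simp [stackUp, stackContour, PTree.contourList, PTree.contour, Function.comp_def,
    add_comm]
  intros
  omega

theorem stackContour_down (r : List (List PTree)) :
    stackContour ([] :: r) = r.length :: stackContour r := by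
  simp [stackContour, PTree.contourList]

theorem sum_stacks_succ (g : List (List PTree) → ℝ) (m L : ℕ) :
    ∑ s ∈ stkSet (m + 1) (L + 1), g s =
      ∑ s ∈ stkSet m (L + 2), g (stackUp s) + ∑ s ∈ stkSet m L, g ([] :: s) := by
  classical
  have e : stkSet (m + 1) (L + 1) =
      (stkSet m (L + 2)).image stackUp ∪ (stkSet m L).image (fun s => [] :: s) := by
    simp only [stkSet]
  rw [e, Finset.sum_union, Finset.sum_image, Finset.sum_image]
  · intro x _ y _ h
    simpa using h
  · intro x hx y hy h
    have h1 := ((mem_stacks _ _ _).1 hx).1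
    have h2 := ((mem_stacks _ _ _).1 hy).1
    match x, y, h1, h2 with
    | a :: b :: r, a' :: b' :: r', _, _ =>
      simp only [stackUp, List.cons.injEq, PTree.node.injEq] at h
      obtain ⟨⟨rfl, rfl⟩, rfl⟩ := h
      rfl
  · rw [Finset.disjoint_left]
    intro s h1 h2
    obtain ⟨x, hx, rfl⟩ := Finset.mem_image.1 h1
    obtain ⟨y, hy, h⟩ := Finset.mem_image.1 h2
    have h1 := ((mem_stacks _ _ _).1 hx).1
    match x, h1 with
    | a :: b :: r, _ => simp [stackUp] at h

theorem stacks_zero (m : ℕ) : stkSet m 0 = ∅ := by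
  cases m <;> simp [stkSet]

theorem card_stacks_succ (m L : ℕ) :
    ((stkSet (m + 1) (L + 1)).card : ℝ) = (stkSet m (L + 2)).card + (stkSet m L).card := by
  have := sum_stacks_succ (fun _ => 1) m L
  simpa using this

theorem card_stacks_ratio (m x : ℕ) :
    (x : ℝ) * (stkSet m (x + 2)).card ≤ (x + 2) * (stkSet m x).card := by
  induction m generalizing x with
  | zero =>
    have : stkSet 0 (x + 2) = ∅ := by simp [stkSet]
    rw [this]
    simp only [Finset.card_empty, Nat.cast_zero, mul_zero]
    positivity
  | succ m ih =>
    match x with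
    | 0 => simp
    | y + 1 =>
      have h1 := ih (y + 2)
      have h2 := ih y
      rw [show y + 1 + 2 = (y + 2) + 1 by ring, card_stacks_succ, card_stacks_succ]
      push_cast at *
      have hy : (0 : ℝ) ≤ y := Nat.cast_nonneg y
      have hy2 : (0 : ℝ) < y + 2 := by linarith
      refine le_of_mul_le_mul_left ?_ hy2
      have h3 := mul_le_mul_of_nonneg_left h1 (show (0 : ℝ) ≤ y + 1 by linarith)
      have h4 := mul_le_mul_of_nonneg_left h2 (show (0 : ℝ) ≤ y + 3 by linarith)
      nlinarith

/-- The test function. -/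
noncomputable def phi (l : ℝ) (x : ℕ) : ℝ := Real.sinh (l * x) / x

theorem phi_mono_aux {l : ℝ} (hl : 0 ≤ l) (n : ℕ) :
    Real.sinh (l * (n + 1)) * Real.cosh l ≤ (n + 1) * Real.cosh (l * (n + 1)) * Real.sinh l := by
  induction n with
  | zero => simp [mul_comm]
  | succ n ih =>
    push_cast
    rw [show l * ((n : ℝ) + 1 + 1) = l * (n + 1) + l by ring, Real.sinh_add, Real.cosh_add]
    have hc : 0 < Real.cosh l := Real.cosh_pos l
    have hs : 0 ≤ Real.sinh l := Real.sinh_nonneg_iff.2 hl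
    have hS : 0 ≤ Real.sinh (l * (n + 1)) := Real.sinh_nonneg_iff.2 (by positivity)
    have h1 := mul_le_mul_of_nonneg_right ih hc.le
    have h2 : 0 ≤ (n + 2) * Real.sinh (l * (n + 1)) * Real.sinh l ^ 2 := by positivity
    nlinarith

theorem phi_nonneg {l : ℝ} (hl : 0 ≤ l) (n : ℕ) : 0 ≤ phi l n :=
  div_nonneg (Real.sinh_nonneg_iff.2 (by positivity)) (by positivity)

theorem phi_mono {l : ℝ} (hl : 0 ≤ l) (n : ℕ) : phi l n ≤ phi l (n + 2) := by
  rcases Nat.eq_zero_or_pos n with rfl | hn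
  · simpa [phi] using phi_nonneg hl 2
  · have h := phi_mono_aux hl n
    have hn' : (0 : ℝ) < n := by exact_mod_cast hn
    unfold phi
    rw [div_le_div_iff₀ hn' (by positivity)]
    push_cast
    rw [show l * ((n : ℝ) + 2) = l * (n + 1) + l by ring,
      show l * (n : ℝ) = l * (n + 1) - l by ring, Real.sinh_add, Real.sinh_sub]
    nlinarith

theorem phi_step (l : ℝ) (n : ℕ) :
    2 * (n + 1) * (Real.cosh l * phi l (n + 1)) =
      (n + 2) * phi l (n + 2) + n * phi l n := by
  have e1 : ((n : ℝ) + 2) * phi l (n + 2) = Real.sinh (l * (n + 2)) := by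
    unfold phi; push_cast; field_simp
  have e2 : (n : ℝ) * phi l n = Real.sinh (l * n) := by
    unfold phi
    rcases Nat.eq_zero_or_pos n with rfl | hn
    · simp
    · field_simp
  have e3 : ((n : ℝ) + 1) * phi l (n + 1) = Real.sinh (l * (n + 1)) := by
    unfold phi; push_cast; field_simp
  have e4 : 2 * (n + 1) * (Real.cosh l * phi l (n + 1)) =
    2 * Real.cosh l * (((n : ℝ) + 1) * phi l (n + 1)) := by ring
  rw [e4, e1, e2, e3, show l * ((n : ℝ) + 2) = l * (n + 1) + l by ring,
      show l * (n : ℝ) = l * (n + 1) - l by ring, Real.sinh_add, Real.sinh_sub]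
  ring

theorem exp_bound {l : ℝ} (hl : 0 ≤ l) (i : ℕ) : ∀ m L : ℕ, i ≤ m →
    ∑ s ∈ stkSet m L, phi l ((stackContour s).getD i 0 + 1) ≤
      (stkSet m L).card * (Real.cosh l ^ i * phi l L) := by
  induction i with
  | zero =>
    intro m L _
    rw [← nsmul_eq_mul]
    refine Finset.sum_le_card_nsmul _ _ _ ?_
    intro s hs
    obtain ⟨h1, h2, -⟩ := (mem_stacks _ _ _).1 hs
    match s, h1 with
    | [], h1 => simp only [List.length_nil] at h1; omega
    | F :: r, h1 =>
      simp only [List.length_cons] at h1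
      simp [stackContour, h1]
  | succ i ih =>
    intro m L him
    match m, L with
    | 0, _ => omega
    | m + 1, 0 => simp [stacks_zero]
    | m + 1, L + 1 =>
      rw [sum_stacks_succ, card_stacks_succ]
      have e1 : ∑ s ∈ stkSet m (L + 2), phi l ((stackContour (stackUp s)).getD (i + 1) 0 + 1)
          = ∑ s ∈ stkSet m (L + 2), phi l ((stackContour s).getD i 0 + 1) := by
        refine Finset.sum_congr rfl fun s hs => ?_
        have h1 := ((mem_stacks _ _ _).1 hs).1
        match s, h1 with
        | a :: b :: r, _ => rw [stackContour_up, List.getD_cons_succ]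
      have e2 : ∑ s ∈ stkSet m L, phi l ((stackContour ([] :: s)).getD (i + 1) 0 + 1)
          = ∑ s ∈ stkSet m L, phi l ((stackContour s).getD i 0 + 1) := by
        refine Finset.sum_congr rfl fun s hs => ?_
        rw [stackContour_down, List.getD_cons_succ]
      rw [e1, e2]
      refine (add_le_add (ih m (L + 2) (by omega)) (ih m L (by omega))).trans ?_
      have hr := card_stacks_ratio m L
      have hm := phi_mono hl L
      have hst := phi_step l L
      have hc : 0 ≤ Real.cosh l ^ i := pow_nonneg (Real.cosh_pos l).le i
      generalize ((stkSet m (L + 2)).card : ℝ) = a at *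
      generalize ((stkSet m L).card : ℝ) = b at *
      have key : a * phi l (L + 2) + b * phi l L ≤ (a + b) * (Real.cosh l * phi l (L + 1)) := by
        have hpos : (0 : ℝ) < 2 * (L + 1) := by positivity
        refine le_of_mul_le_mul_left ?_ hpos
        have : 2 * ((L : ℝ) + 1) * ((a + b) * (Real.cosh l * phi l (L + 1))) =
            (a + b) * ((L + 2) * phi l (L + 2) + L * phi l L) := by
          rw [← hst]; ring
        rw [this]
        nlinarith [mul_nonneg (sub_nonneg.2 hr) (sub_nonneg.2 hm)]
      calc a * (Real.cosh l ^ i * phi l (L + 2)) + b * (Real.cosh l ^ i * phi l L)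
          = Real.cosh l ^ i * (a * phi l (L + 2) + b * phi l L) := by ring
        _ ≤ Real.cosh l ^ i * ((a + b) * (Real.cosh l * phi l (L + 1))) :=
            mul_le_mul_of_nonneg_left key hc
        _ = _ := by ring

theorem sinh_lower {u : ℝ} (hu : 0 ≤ u) (p : ℕ) :
    u ^ (2 * p + 1) / (2 * p + 1).factorial ≤ Real.sinh u :=
  le_hasSum (Real.hasSum_sinh u) p (fun j _ => by positivity)

theorem phi_lower {l : ℝ} (hl : 0 ≤ l) (p n : ℕ) :
    l ^ (2 * p + 1) * (n : ℝ) ^ (2 * p) ≤ (2 * p + 1).factorial * phi l (n + 1) := by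
  have h := sinh_lower (u := l * (n + 1 : ℕ)) (by positivity) p
  rw [div_le_iff₀ (by positivity)] at h
  have hx : (0 : ℝ) < (n + 1 : ℕ) := by positivity
  unfold phi
  rw [← mul_div_assoc, le_div_iff₀ hx, mul_comm _ (Real.sinh _)]
  refine le_trans ?_ h
  rw [mul_pow, pow_succ ((n + 1 : ℕ) : ℝ), mul_assoc]
  have : (n : ℝ) ^ (2 * p) ≤ ((n + 1 : ℕ) : ℝ) ^ (2 * p) := by
    gcongr; simp
  gcongr

theorem phi_one_upper {l : ℝ} (hl : 0 ≤ l) (hl1 : l ≤ 1) : phi l 1 ≤ 2 * l := by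
  have h1 := Real.abs_exp_sub_one_le (x := l) (by rwa [abs_of_nonneg hl])
  have h2 := Real.abs_exp_sub_one_le (x := -l) (by rwa [abs_neg, abs_of_nonneg hl])
  rw [abs_neg] at h2
  rw [abs_of_nonneg hl] at h1 h2
  have h1 := (abs_le.1 h1).2
  have h2 := (abs_le.1 h2).1
  simp only [phi, Nat.cast_one, mul_one, div_one, Real.sinh_eq]
  linarith

theorem stack_moment (p m i : ℕ) (hi : 1 ≤ i) (him : i ≤ m) :
    ∑ s ∈ stkSet m 1, (((stackContour s).getD i 0 : ℕ) : ℝ) ^ (2 * p) ≤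
      ((2 * p + 1).factorial * (2 * Real.exp (1 / 2))) * (i : ℝ) ^ p * (stkSet m 1).card := by
  have hi' : (1 : ℝ) ≤ i := by exact_mod_cast hi
  set r := Real.sqrt i with hr
  have hr1 : 1 ≤ r := Real.one_le_sqrt.2 hi'
  have hr2 : r ^ 2 = i := Real.sq_sqrt (by positivity)
  have hr0 : 0 < r := by linarith
  set l := r⁻¹ with hl
  have hl0 : 0 < l := inv_pos.2 hr0
  have hl1 : l ≤ 1 := inv_le_one_of_one_le₀ hr1
  have hrl : r * l = 1 := mul_inv_cancel₀ hr0.ne'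
  have hb := exp_bound hl0.le i m 1 him
  have hcosh : Real.cosh l ^ i ≤ Real.exp (1 / 2) := by
    calc Real.cosh l ^ i ≤ Real.exp (l ^ 2 / 2) ^ i :=
          pow_le_pow_left₀ (Real.cosh_pos l).le (Real.cosh_le_exp_half_sq l) i
      _ = Real.exp (1 / 2) := by
          rw [← Real.exp_nat_mul, ← hr2]
          congr 1
          rw [show r ^ 2 * (l ^ 2 / 2) = (r * l) ^ 2 / 2 by ring, hrl]; norm_num
  have hphi := phi_one_upper hl0.le hl1
  have hf : l ^ (2 * p + 1) * ∑ s ∈ stkSet m 1, (((stackContour s).getD i 0 : ℕ) : ℝ) ^ (2 * p) ≤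
      (2 * p + 1).factorial * ((stkSet m 1).card * (Real.exp (1 / 2) * (2 * l))) := by
    rw [Finset.mul_sum]
    refine (Finset.sum_le_sum fun s _ => phi_lower hl0.le p _).trans ?_
    rw [← Finset.mul_sum]
    refine mul_le_mul_of_nonneg_left (hb.trans ?_) (by positivity)
    refine mul_le_mul_of_nonneg_left ?_ (by positivity)
    exact mul_le_mul hcosh hphi (phi_nonneg hl0.le 1) (by positivity)
  have hmul := mul_le_mul_of_nonneg_left hf (show 0 ≤ r ^ (2 * p + 1) by positivity)
  rw [← mul_assoc, ← mul_pow, hrl, one_pow, one_mul] at hmul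
  refine hmul.trans (le_of_eq ?_)
  rw [pow_succ, pow_mul, hr2]
  linear_combination ((2 * p + 1).factorial * (2 * Real.exp (1 / 2))) * (i : ℝ) ^ p *
    (stkSet m 1).card * hrl

/-- Moment bound for the contour function of a uniform plane tree: for every `p ≥ 1`
there is a constant `K_p` such that for all `k ≥ 1` and `i ∈ {0, ..., 2k}`,
`E[C_k(i)^{2p}] ≤ K_p i^p`, where the expectation is the average over the (finite) set
of all plane trees with `k` edges, represented by a Finset `A`. -/
theorem contour_moment_bound (p : ℕ) (hp : 1 ≤ p) :
    ∃ K : ℝ, ∀ k : ℕ, 1 ≤ k → ∀ i ≤ 2 * k, ∀ A : Finset PTree,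
      (∀ t, t ∈ A ↔ t.numEdges = k) →
      (∑ t ∈ A, ((t.contour.getD i 0 : ℝ)) ^ (2 * p)) / (A.card : ℝ)
        ≤ K * (i : ℝ) ^ p := by
  refine ⟨(2 * p + 1).factorial * (2 * Real.exp (1 / 2)), ?_⟩
  intro k hk i hi A hA
  rcases Nat.eq_zero_or_pos i with rfl | hi0
  · have : ∀ t ∈ A, ((t.contour.getD 0 0 : ℕ) : ℝ) ^ (2 * p) = 0 := by
      rintro ⟨ts⟩ _
      simp [PTree.contour]
      omega
    rw [Finset.sum_eq_zero this, zero_div]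
    positivity
  have hinj : ∀ s ∈ stkSet (2 * k) 1, ∃ ts, s = [ts] ∧ PTree.node ts ∈ A := by
    intro s hs
    obtain ⟨h1, -, h2⟩ := (mem_stacks _ _ _).1 hs
    match s, h1 with
    | [ts], _ =>
      refine ⟨ts, rfl, (hA _).2 ?_⟩
      simp only [stackEdges, PTree.numEdges] at *
      omega
  have hmem : ∀ ts, PTree.node ts ∈ A → [ts] ∈ stkSet (2 * k) 1 := by
    intro ts h
    have := (hA _).1 h
    rw [PTree.numEdges] at this
    rw [mem_stacks]
    refine ⟨rfl, le_rfl, ?_⟩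
    simp only [stackEdges]
    omega
  have hsum : ∀ g : List ℕ → ℝ, ∑ t ∈ A, g t.contour =
      ∑ s ∈ stkSet (2 * k) 1, g (stackContour s) := by
    intro g
    refine Finset.sum_bij (fun t _ => match t with | .node ts => [ts]) ?_ ?_ ?_ ?_
    · rintro ⟨ts⟩ h
      exact hmem ts h
    · rintro ⟨ts⟩ _ ⟨ts'⟩ _ h
      simpa using h
    · intro s hs
      obtain ⟨ts, rfl, h⟩ := hinj s hs
      exact ⟨_, h, rfl⟩
    · rintro ⟨ts⟩ h
      simp [stackContour, PTree.contour]
  have hcard : (A.card : ℝ) = (stkSet (2 * k) 1).card := by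
    simpa using hsum (fun _ => 1)
  have hm := stack_moment p (2 * k) i hi0 hi
  rw [hsum (fun c => ((c.getD i 0 : ℕ) : ℝ) ^ (2 * p)), hcard]
  exact div_le_of_le_mul₀ (by positivity) (by positivity) hm
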